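/- There exists a constant C > 0 such that for every n ∈ ℕ⁺ there exists M = M(n) > 0 with the following property: whenever d^1,…,d^n ∈ ℤ^d \ {0} satisfy |d^{k+1}| > M |d^k| for k = 1,…,n−1, then ∫_{[0,1]^d} | ∑_{j=1}^n e^{2πi⟨d^j,ξ⟩} ∏_{1≤k<j} (1 + cos(2π⟨d^k,ξ⟩)) | dξ ≥ C n. -/

import Mathlib

open MeasureTheory Filter Real Topology

/-- Euclidean norm of an integer vector in `ℤ^d`. -/
noncomputable def intNorm {d : ℕ} (n : Fin d → ℤ) : ℝ :=
  Real.sqrt (∑ i, ((n i : ℝ)) ^ 2)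

/-- The exponential Riesz-product sum as a function on the torus. -/
noncomputable def rieszSum (n : ℕ) (y : Fin n → UnitAddCircle) : ℂ :=
  ∑ j : Fin n, fourier 1 (y j) * ∏ k ∈ Finset.Iio j, ((1 + (fourier 1 (y k)).re : ℝ) : ℂ)

lemma continuous_rieszSum (n : ℕ) : Continuous (rieszSum n) := by
  unfold rieszSum
  fun_prop

lemma rieszSum_cons (n : ℕ) (x : UnitAddCircle) (z : Fin n → UnitAddCircle) :
    rieszSum (n + 1) (Fin.cons x z : Fin (n + 1) → UnitAddCircle) =
      fourier 1 x + ((1 + (fourier 1 x).re : ℝ) : ℂ) * rieszSum n z := by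
  have h : ∀ j : Fin n, Finset.Iio j.succ = Finset.cons 0 ((Finset.Iio j).map (Fin.succEmb n))
      (by simp) := by
    intro j
    ext k
    induction k using Fin.cases <;> simp
  simp only [rieszSum, Fin.sum_univ_succ, h, Finset.prod_cons, Finset.prod_map, Fin.cons_zero,
    Fin.cons_succ, Fin.coe_succEmb, Finset.mul_sum]
  congr 1
  · have : Finset.Iio (0 : Fin (n + 1)) = ∅ := by ext; simp
    simp [this]
  · exact Finset.sum_congr rfl fun j _ => by ring

/-- The product of normalised Haar measures on the torus. -/
noncomputable abbrev torusMeasure (ι : Type*) [Fintype ι] : Measure (ι → UnitAddCircle) :=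
  Measure.pi fun _ => AddCircle.haarAddCircle

lemma Continuous.integrable_of_compactSpace {X E : Type*} [TopologicalSpace X] [CompactSpace X]
    [MeasurableSpace X] [OpensMeasurableSpace X] [NormedAddCommGroup E]
    [SecondCountableTopologyEither X E] {μ : Measure X}
    [IsFiniteMeasure μ] {f : X → E} (hf : Continuous f) : Integrable f μ :=
  hf.integrable_of_hasCompactSupport (HasCompactSupport.of_compactSpace f)

lemma integral_torusMeasure_succ {n : ℕ} {f : (Fin (n + 1) → UnitAddCircle) → ℝ}
    (hf : Continuous f) :
    ∫ y, f y ∂torusMeasure (Fin (n + 1)) =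
      ∫ z, ∫ x, f (Fin.cons x z : Fin (n + 1) → UnitAddCircle) ∂AddCircle.haarAddCircle
        ∂torusMeasure (Fin n) := by
  have h := (measurePreserving_piFinSuccAbove
    (fun _ : Fin (n + 1) => (AddCircle.haarAddCircle : Measure UnitAddCircle)) 0).symm
  rw [← h.integral_comp', integral_prod_symm]
  · simp [MeasurableEquiv.piFinSuccAbove, Fin.insertNthEquiv]
  · have : Continuous fun p : UnitAddCircle × (Fin n → UnitAddCircle) =>
        f (Fin.cons p.1 p.2 : Fin (n + 1) → UnitAddCircle) := by fun_prop
    simpa [MeasurableEquiv.piFinSuccAbove, Fin.insertNthEquiv] using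
      this.integrable_of_compactSpace

lemma integral_fourier_eq_zero {m : ℤ} (hm : m ≠ 0) :
    ∫ x : UnitAddCircle, fourier m x ∂AddCircle.haarAddCircle = 0 :=
  integral_eq_zero_of_add_right_eq_neg (fourier_add_half_inv_index hm one_pos)

lemma integral_re_mul_fourier (u : ℂ) {m : ℤ} (hm : m ≠ 0) :
    ∫ x : UnitAddCircle, (u * fourier m x).re ∂AddCircle.haarAddCircle = 0 := by
  have h : Integrable (fun x : UnitAddCircle => u * fourier m x) AddCircle.haarAddCircle :=
    Continuous.integrable_of_compactSpace (by fun_prop)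
  have := integral_re h
  simp only [RCLike.re_to_complex] at this
  rw [this, integral_const_mul, integral_fourier_eq_zero hm]
  simp

lemma le_norm_fourier_add_pointwise {z u s : ℂ} (hz : ‖z‖ = 1) (hu : ‖u‖ = 1)
    (hs : u * s = ‖s‖) :
    (u * z).re + (1 + z.re) * ‖s‖ + (1 - (u ^ 2 * z ^ 2).re) / (4 * (1 + 2 * ‖s‖)) ≤
      ‖z + ((1 + z.re : ℝ) : ℂ) * s‖ := by
  set r := ‖s‖ with hr
  have hr0 : 0 ≤ r := norm_nonneg _
  set w := u * z with hw
  have hwn : ‖w‖ = 1 := by simp [hw, hz, hu]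
  have hre := Complex.abs_re_le_norm z
  rw [hz, abs_le] at hre
  have e1 : ‖z + ((1 + z.re : ℝ) : ℂ) * s‖ = ‖w + ((1 + z.re) * r : ℝ)‖ := by
    rw [← one_mul ‖z + _‖, ← hu, ← norm_mul]
    congr 1
    push_cast
    rw [← hs, hw]
    ring
  rw [e1]
  set q := (1 + z.re) * r with hq
  have hq0 : 0 ≤ q := mul_nonneg (by linarith) hr0
  have hq2 : q ≤ 2 * r := mul_le_mul_of_nonneg_right (by linarith) hr0
  set N := ‖w + (q : ℝ)‖ with hN
  have hN2 : N ^ 2 = (w.re + q) ^ 2 + w.im ^ 2 := by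
    rw [hN, ← Complex.normSq_eq_norm_sq, Complex.normSq_apply]
    simp
    ring
  have hw2 : w.re ^ 2 + w.im ^ 2 = 1 := by
    have := Complex.normSq_eq_norm_sq w
    rw [Complex.normSq_apply, hwn] at this
    linarith
  have hww : (u ^ 2 * z ^ 2).re = w.re ^ 2 - w.im ^ 2 := by
    rw [← mul_pow, ← hw, pow_two, Complex.mul_re]
    ring
  have hNle : N ≤ 1 + 2 * r := by
    refine (norm_add_le _ _).trans ?_
    rw [hwn, Complex.norm_real, Real.norm_of_nonneg hq0]
    linarith
  have hN0 : 0 ≤ N := norm_nonneg _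
  have hNa : |w.re + q| ≤ N := abs_le_of_sq_le_sq (by nlinarith) hN0
  rw [abs_le] at hNa
  rw [hww]
  have : (1 - (w.re ^ 2 - w.im ^ 2)) / (4 * (1 + 2 * r)) ≤ N - (w.re + q) := by
    rw [div_le_iff₀ (by positivity)]
    nlinarith
  linarith

lemma integral_norm_fourier_add_ge (s : ℂ) :
    ‖s‖ + 1 / (4 * (1 + 2 * ‖s‖)) ≤
      ∫ x : UnitAddCircle, ‖fourier 1 x + ((1 + (fourier 1 x).re : ℝ) : ℂ) * s‖
        ∂AddCircle.haarAddCircle := by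
  obtain ⟨u, hu, hs⟩ : ∃ u : ℂ, ‖u‖ = 1 ∧ u * s = ‖s‖ := by
    rcases eq_or_ne s 0 with rfl | h
    · exact ⟨1, by simp, by simp⟩
    · have h' : (‖s‖ : ℂ) ≠ 0 := by simpa using h
      refine ⟨‖s‖ / s, by simp [h], by field_simp⟩
  set r := ‖s‖
  have key : ∫ x : UnitAddCircle, ((u * fourier 1 x).re + (r + ((r : ℂ) * fourier 1 x).re) +
      (1 - (u ^ 2 * fourier 2 x).re) / (4 * (1 + 2 * r))) ∂AddCircle.haarAddCircle =
      r + 1 / (4 * (1 + 2 * r)) := by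
    rw [integral_add, integral_add, integral_add, integral_div, integral_sub,
      integral_re_mul_fourier _ one_ne_zero, integral_re_mul_fourier _ one_ne_zero,
      integral_re_mul_fourier _ two_ne_zero]
    · simp
    all_goals exact Continuous.integrable_of_compactSpace (by fun_prop)
  rw [← key]
  apply integral_mono
  · exact Continuous.integrable_of_compactSpace (by fun_prop)
  · exact Continuous.integrable_of_compactSpace (by fun_prop)
  · intro x
    have h2 : fourier 2 x = fourier 1 x ^ 2 := by
      rw [show (2 : ℤ) = 1 + 1 by norm_num, fourier_add, pow_two]
    have := le_norm_fourier_add_pointwise (z := fourier 1 x) (Circle.norm_coe _) hu hs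
    simp only [h2]
    refine le_trans (le_of_eq ?_) this
    rw [Complex.re_ofReal_mul]
    ring

lemma Real.sqrt_one_add_le_sub_sq {c : ℝ} (h : |c| ≤ 1) : √(1 + c) ≤ 1 + c / 2 - c ^ 2 / 16 := by
  rw [abs_le] at h
  refine Real.sqrt_le_iff.2 ⟨by nlinarith, ?_⟩
  nlinarith [mul_nonneg (sq_nonneg c) (by linarith : 0 ≤ 1 - c), sq_nonneg (c ^ 2)]

lemma integral_sqrt_norm_fourier_add_le (s : ℂ) :
    ∫ x : UnitAddCircle, √‖fourier 1 x + ((1 + (fourier 1 x).re : ℝ) : ℂ) * s‖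
        ∂AddCircle.haarAddCircle ≤ 1 + 31 / 32 * √‖s‖ := by
  have key : ∫ x : UnitAddCircle, (1 + (31 / 32 + ((1 / 2 : ℂ) * fourier 1 x).re -
      ((1 / 32 : ℂ) * fourier 2 x).re) * √‖s‖) ∂AddCircle.haarAddCircle =
      1 + 31 / 32 * √‖s‖ := by
    rw [integral_add, integral_mul_const, integral_sub, integral_add,
      integral_re_mul_fourier _ one_ne_zero, integral_re_mul_fourier _ two_ne_zero]
    · simp
    all_goals exact Continuous.integrable_of_compactSpace (by fun_prop)
  rw [← key]
  apply integral_mono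
  · exact Continuous.integrable_of_compactSpace (by fun_prop)
  · exact Continuous.integrable_of_compactSpace (by fun_prop)
  · intro x
    have h2 : fourier 2 x = fourier 1 x ^ 2 := by
      rw [show (2 : ℤ) = 1 + 1 by norm_num, fourier_add, pow_two]
    have hz : ‖fourier 1 x‖ = 1 := Circle.norm_coe _
    simp only [h2]
    generalize fourier 1 x = z at hz
    have hre := Complex.abs_re_le_norm z
    rw [hz] at hre
    have hre' := abs_le.1 hre
    have hz2 : z.re ^ 2 + z.im ^ 2 = 1 := by
      have := Complex.normSq_eq_norm_sq z
      rw [Complex.normSq_apply, hz] at this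
      linarith
    have h1 : ((1 / 2 : ℂ) * z).re = z.re / 2 := by
      simp [Complex.mul_re]; ring
    have h3 : ((1 / 32 : ℂ) * z ^ 2).re = (z.re ^ 2 - z.im ^ 2) / 32 := by
      simp [Complex.mul_re, pow_two]; ring
    rw [h1, h3]
    calc √‖z + ((1 + z.re : ℝ) : ℂ) * s‖ ≤ √(1 + (1 + z.re) * ‖s‖) := by
          apply Real.sqrt_le_sqrt
          refine (norm_add_le _ _).trans ?_
          rw [hz, norm_mul, Complex.norm_real, Real.norm_of_nonneg (by linarith)]
      _ ≤ 1 + √(1 + z.re) * √‖s‖ := by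
          rw [← Real.sqrt_mul (by linarith)]
          have hq : 0 ≤ (1 + z.re) * ‖s‖ := mul_nonneg (by linarith) (norm_nonneg _)
          refine Real.sqrt_le_iff.2 ⟨by positivity, ?_⟩
          nlinarith [Real.sq_sqrt hq, Real.sqrt_nonneg ((1 + z.re) * ‖s‖)]
      _ ≤ _ := by
          have := Real.sqrt_one_add_le_sub_sq hre
          gcongr
          nlinarith

lemma integral_sqrt_norm_rieszSum_le (n : ℕ) :
    ∫ y, √‖rieszSum n y‖ ∂torusMeasure (Fin n) ≤ 32 := by
  induction n with
  | zero => simp [rieszSum]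
  | succ n ih =>
    have hc := continuous_rieszSum n
    rw [integral_torusMeasure_succ (by have := continuous_rieszSum (n + 1); fun_prop)]
    simp only [rieszSum_cons]
    calc _ ≤ ∫ z, (1 + 31 / 32 * √‖rieszSum n z‖) ∂torusMeasure (Fin n) := by
          apply integral_mono_of_nonneg
          · exact .of_forall fun z => integral_nonneg fun x => Real.sqrt_nonneg _
          · exact Continuous.integrable_of_compactSpace (by fun_prop)
          · exact .of_forall fun z => integral_sqrt_norm_fourier_add_le _
      _ = 1 + 31 / 32 * ∫ z, √‖rieszSum n z‖ ∂torusMeasure (Fin n) := by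
          rw [integral_add, integral_const_mul]
          · simp
          all_goals exact Continuous.integrable_of_compactSpace (by fun_prop)
      _ ≤ 32 := by linarith

lemma one_div_one_add_sq_ge {t : ℝ} (ht : 0 ≤ t) :
    1 / 32772 - t / 2097408 ≤ 1 / (4 * (1 + 2 * t ^ 2)) := by
  rcases le_total t 64 with h | h
  · have : (1 : ℝ) / 32772 ≤ 1 / (4 * (1 + 2 * t ^ 2)) := by
      apply one_div_le_one_div_of_le <;> nlinarith
    linarith [div_nonneg ht (by norm_num : (0 : ℝ) ≤ 2097408)]
  · have : 0 ≤ 1 / (4 * (1 + 2 * t ^ 2)) := by positivity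
    linarith

lemma integral_norm_rieszSum_ge (n : ℕ) :
    1 / 65544 * n ≤ ∫ y, ‖rieszSum n y‖ ∂torusMeasure (Fin n) := by
  induction n with
  | zero => simp [rieszSum]
  | succ n ih =>
    have hc := continuous_rieszSum n
    have hc' := continuous_rieszSum (n + 1)
    rw [integral_torusMeasure_succ (by fun_prop)]
    simp only [rieszSum_cons]
    have h32 := integral_sqrt_norm_rieszSum_le n
    have hcont : Continuous fun z : Fin n → UnitAddCircle => ∫ x : UnitAddCircle,
        ‖fourier 1 x + ((1 + (fourier 1 x).re : ℝ) : ℂ) * rieszSum n z‖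
          ∂AddCircle.haarAddCircle := by
      have := continuous_parametric_integral_of_continuous (s := Set.univ)
        (μ := (AddCircle.haarAddCircle : Measure UnitAddCircle))
        (f := fun z x => ‖fourier 1 x + ((1 + (fourier 1 x).re : ℝ) : ℂ) * rieszSum n z‖)
        (by fun_prop) isCompact_univ
      simpa using this
    calc 1 / 65544 * ((n + 1 : ℕ) : ℝ) ≤ (∫ z, ‖rieszSum n z‖ ∂torusMeasure (Fin n)) +
          (1 / 32772 - (∫ z, √‖rieszSum n z‖ ∂torusMeasure (Fin n)) / 2097408) := by
          push_cast
          linarith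
      _ = ∫ z, (‖rieszSum n z‖ + (1 / 32772 - √‖rieszSum n z‖ / 2097408))
            ∂torusMeasure (Fin n) := by
          rw [integral_add, integral_sub, integral_div]
          · simp [integral_div]
          all_goals exact Continuous.integrable_of_compactSpace (by fun_prop)
      _ ≤ _ := by
          apply integral_mono
          · exact Continuous.integrable_of_compactSpace (by fun_prop)
          · exact hcont.integrable_of_compactSpace
          · intro z
            have h := one_div_one_add_sq_ge (Real.sqrt_nonneg ‖rieszSum n z‖)
            rw [Real.sq_sqrt (norm_nonneg _)] at h
            have := integral_norm_fourier_add_ge (rieszSum n z)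
            simp only
            linarith

lemma AddCircle.integral_Icc_coe {E : Type*} [NormedAddCommGroup E] [NormedSpace ℝ E]
    (f : UnitAddCircle → E) :
    ∫ x in Set.Icc (0 : ℝ) 1, f x = ∫ x, f x ∂AddCircle.haarAddCircle := by
  rw [integral_Icc_eq_integral_Ioc, AddCircle.integral_haarAddCircle,
    ← AddCircle.integral_preimage 1 0]
  simp

lemma integral_Icc_exp_eq_zero {d : ℕ} {w : Fin d → ℤ} (hw : w ≠ 0) :
    ∫ ξ in Set.Icc (0 : Fin d → ℝ) 1, ∏ i, fourier (w i) (ξ i : UnitAddCircle) = 0 := by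
  obtain ⟨i, hi⟩ := Function.ne_iff.mp hw
  rw [← Set.pi_univ_Icc, volume_pi, Measure.restrict_pi_pi,
    integral_fintype_prod_eq_prod (fun i (x : ℝ) => fourier (w i) (x : UnitAddCircle))]
  refine Finset.prod_eq_zero (Finset.mem_univ i) ?_
  simp only [Pi.zero_apply, Pi.one_apply]
  rw [AddCircle.integral_Icc_coe (fun x => fourier (w i) x), integral_fourier_eq_zero hi]

lemma integral_mFourier_eq_zero {n : ℕ} {m : Fin n → ℤ} (hm : m ≠ 0) :
    ∫ y, UnitAddTorus.mFourier m y ∂torusMeasure (Fin n) = 0 := by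
  obtain ⟨i, hi⟩ := Function.ne_iff.mp hm
  simp only [UnitAddTorus.mFourier, ContinuousMap.coe_mk]
  rw [integral_fintype_prod_eq_prod (fun i (x : UnitAddCircle) => fourier (m i) x)]
  exact Finset.prod_eq_zero (Finset.mem_univ i) (integral_fourier_eq_zero hi)

/-- The phases `⟨v k, ξ⟩` modulo one. -/
noncomputable def phases {d n : ℕ} (v : Fin n → Fin d → ℤ) (ξ : Fin d → ℝ) :
    Fin n → UnitAddCircle :=
  fun k => ((∑ i, (v k i : ℝ) * ξ i : ℝ) : UnitAddCircle)

lemma continuous_phases {d n : ℕ} (v : Fin n → Fin d → ℤ) : Continuous (phases v) :=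
  continuous_pi fun _ => (AddCircle.continuous_mk' 1).comp (by fun_prop)

lemma mFourier_phases {d n : ℕ} (v : Fin n → Fin d → ℤ) (m : Fin n → ℤ) (ξ : Fin d → ℝ) :
    UnitAddTorus.mFourier m (phases v ξ) =
      ∏ i, fourier (∑ k, m k * v k i) (ξ i : UnitAddCircle) := by
  simp only [UnitAddTorus.mFourier, ContinuousMap.coe_mk, phases, fourier_coe_apply,
    ← Complex.exp_sum]
  congr 1
  push_cast
  simp only [Finset.mul_sum, Finset.sum_mul, div_one]
  rw [Finset.sum_comm]
  exact Finset.sum_congr rfl fun _ _ => Finset.sum_congr rfl fun _ _ => by ring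

lemma intNorm_eq_norm {d : ℕ} (w : Fin d → ℤ) :
    intNorm w = ‖WithLp.toLp 2 (fun i => (w i : ℝ))‖ := by
  simp [intNorm, EuclideanSpace.norm_eq]

lemma intNorm_nonneg {d : ℕ} (w : Fin d → ℤ) : 0 ≤ intNorm w := Real.sqrt_nonneg _

lemma intNorm_pos {d : ℕ} {w : Fin d → ℤ} (hw : w ≠ 0) : 0 < intNorm w := by
  rw [intNorm_eq_norm, norm_pos_iff]
  contrapose! hw
  ext i
  simpa using congrArg (fun z : EuclideanSpace ℝ (Fin d) => z i) hw

/-- Each vector is more than `M` times longer than its predecessor. -/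
def IsLacunary {d n : ℕ} (M : ℝ) (v : Fin n → Fin d → ℤ) : Prop :=
  ∀ k l : Fin n, (l : ℕ) = (k : ℕ) + 1 → M * intNorm (v k) < intNorm (v l)

lemma IsLacunary.mono {d n : ℕ} {M M' : ℝ} {v : Fin n → Fin d → ℤ} (h : IsLacunary M v)
    (hM : M' ≤ M) : IsLacunary M' v := fun k l hkl =>
  (mul_le_mul_of_nonneg_right hM (intNorm_nonneg _)).trans_lt (h k l hkl)

lemma IsLacunary.mul_intNorm_lt {d n : ℕ} {M : ℝ} {v : Fin n → Fin d → ℤ} (h : IsLacunary M v)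
    (hM : 1 ≤ M) {k l : Fin n} (hkl : k < l) : M * intNorm (v k) < intNorm (v l) := by
  obtain ⟨l, hl⟩ := l
  induction l with
  | zero => simp [Fin.lt_def] at hkl
  | succ l ih =>
    have hl' : l < n := by omega
    have hstep := h ⟨l, hl'⟩ ⟨l + 1, hl⟩ rfl
    rcases (Nat.lt_succ_iff.1 (Fin.lt_def.1 hkl)).eq_or_lt with he | hlt
    · have : k = ⟨l, hl'⟩ := Fin.ext he
      rwa [this]
    · have h1 := ih hl' (Fin.lt_def.2 hlt)
      have := le_mul_of_one_le_left (intNorm_nonneg (v ⟨l, hl'⟩)) hM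
      linarith

lemma IsLacunary.sum_mul_ne_zero {d n : ℕ} {M : ℝ} {v : Fin n → Fin d → ℤ} (h : IsLacunary M v)
    (hv : ∀ k, v k ≠ 0) {m : Fin n → ℤ} (hm : m ≠ 0) (hM : 1 + ∑ k, |(m k : ℝ)| ≤ M) :
    (fun i => ∑ k, m k * v k i) ≠ 0 := by
  intro h0
  have hS : 0 ≤ ∑ k, |(m k : ℝ)| := Finset.sum_nonneg fun _ _ => abs_nonneg _
  set s : Finset (Fin n) := Finset.univ.filter fun k => m k ≠ 0 with hs
  have hne : s.Nonempty := by
    obtain ⟨i, hi⟩ := Function.ne_iff.mp hm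
    exact ⟨i, by simpa [hs] using hi⟩
  set K := s.max' hne with hK
  have hmK : m K ≠ 0 := (Finset.mem_filter.1 (s.max'_mem hne)).2
  have hle : ∀ k, m k ≠ 0 → k ≤ K := fun k hk => s.le_max' k (by simpa [hs] using hk)
  let V : Fin n → EuclideanSpace ℝ (Fin d) := fun k => WithLp.toLp 2 (fun i => (v k i : ℝ))
  have hsum : ∑ k, (m k : ℝ) • V k = 0 := by
    ext i
    have := congrArg (Int.cast (R := ℝ)) (congrFun h0 i)
    simpa [V] using this
  rw [← Finset.add_sum_erase _ _ (Finset.mem_univ K), add_eq_zero_iff_eq_neg] at hsum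
  have hpos : 0 < ‖V K‖ := by simpa [V, ← intNorm_eq_norm] using intNorm_pos (hv K)
  have hother : ∀ k ∈ Finset.univ.erase K, M * ‖(m k : ℝ) • V k‖ ≤ |(m k : ℝ)| * ‖V K‖ := by
    intro k hk
    rw [norm_smul, Real.norm_eq_abs]
    rcases eq_or_ne (m k) 0 with h0 | h0
    · simp [h0]
    · have hlt : k < K := lt_of_le_of_ne (hle k h0) (Finset.ne_of_mem_erase hk)
      have := (h.mul_intNorm_lt (by linarith) hlt).le
      rw [intNorm_eq_norm, intNorm_eq_norm] at this
      calc M * (|(m k : ℝ)| * ‖V k‖) = |(m k : ℝ)| * (M * ‖V k‖) := by ring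
        _ ≤ _ := by gcongr
  have hone : ‖V K‖ ≤ ‖(m K : ℝ) • V K‖ := by
    rw [norm_smul, Real.norm_eq_abs]
    refine le_mul_of_one_le_left hpos.le ?_
    exact_mod_cast Int.one_le_abs hmK
  have hfinal : M * ‖V K‖ ≤ (∑ k, |(m k : ℝ)|) * ‖V K‖ :=
    calc M * ‖V K‖ ≤ M * ‖(m K : ℝ) • V K‖ := by gcongr; linarith
      _ ≤ M * ∑ k ∈ Finset.univ.erase K, ‖(m k : ℝ) • V k‖ := by
        rw [hsum, norm_neg]
        gcongr
        · linarith
        · exact norm_sum_le _ _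
      _ ≤ ∑ k ∈ Finset.univ.erase K, |(m k : ℝ)| * ‖V K‖ := by
        rw [Finset.mul_sum]
        exact Finset.sum_le_sum hother
      _ ≤ ∑ k, |(m k : ℝ)| * ‖V K‖ :=
        Finset.sum_le_sum_of_subset_of_nonneg (Finset.subset_univ _)
          fun _ _ _ => by positivity
      _ = _ := by rw [Finset.sum_mul]
  nlinarith

instance isProbabilityMeasure_restrict_Icc_zero_one (d : ℕ) :
    IsProbabilityMeasure (volume.restrict (Set.Icc (0 : Fin d → ℝ) 1)) :=
  ⟨by simp [Real.volume_Icc_pi]⟩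

lemma integrableOn_comp_phases {d n : ℕ} (v : Fin n → Fin d → ℤ)
    (f : C(UnitAddTorus (Fin n), ℂ)) :
    IntegrableOn (fun ξ => f (phases v ξ)) (Set.Icc (0 : Fin d → ℝ) 1) :=
  (f.continuous.comp (continuous_phases v)).continuousOn.integrableOn_compact isCompact_Icc

lemma exists_integral_comp_phases_eq {d n : ℕ} {f : C(UnitAddTorus (Fin n), ℂ)}
    (hf : f ∈ Submodule.span ℂ (Set.range (UnitAddTorus.mFourier (d := Fin n)))) :
    ∃ M : ℝ, ∀ v : Fin n → Fin d → ℤ, (∀ k, v k ≠ 0) → IsLacunary M v →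
      ∫ ξ in Set.Icc (0 : Fin d → ℝ) 1, f (phases v ξ) = ∫ y, f y ∂torusMeasure (Fin n) := by
  induction hf using Submodule.span_induction with
  | mem f hf =>
    obtain ⟨m, rfl⟩ := hf
    rcases eq_or_ne m 0 with rfl | hm
    · exact ⟨0, fun v _ _ => by simp [UnitAddTorus.mFourier_zero]⟩
    · refine ⟨1 + ∑ k, |(m k : ℝ)|, fun v hv hl => ?_⟩
      simp only [mFourier_phases]
      rw [integral_mFourier_eq_zero hm,
        integral_Icc_exp_eq_zero (hl.sum_mul_ne_zero hv hm le_rfl)]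
  | zero => exact ⟨0, fun v _ _ => by simp⟩
  | add f g _ _ hf hg =>
    obtain ⟨M, hM⟩ := hf
    obtain ⟨M', hM'⟩ := hg
    refine ⟨max M M', fun v hv hl => ?_⟩
    simp only [ContinuousMap.add_apply]
    rw [integral_add (integrableOn_comp_phases v f) (integrableOn_comp_phases v g),
      integral_add f.continuous.integrable_of_compactSpace
        g.continuous.integrable_of_compactSpace,
      hM v hv (hl.mono (le_max_left _ _)), hM' v hv (hl.mono (le_max_right _ _))]
  | smul a f _ hf =>
    obtain ⟨M, hM⟩ := hf
    refine ⟨M, fun v hv hl => ?_⟩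
    simp only [ContinuousMap.smul_apply]
    rw [integral_smul, integral_smul, hM v hv hl]

lemma exists_norm_integral_comp_phases_sub_le {n : ℕ} (d : ℕ) (f : C(UnitAddTorus (Fin n), ℂ))
    {ε : ℝ} (hε : 0 < ε) :
    ∃ M : ℝ, ∀ v : Fin n → Fin d → ℤ, (∀ k, v k ≠ 0) → IsLacunary M v →
      ‖(∫ ξ in Set.Icc (0 : Fin d → ℝ) 1, f (phases v ξ)) -
        ∫ y, f y ∂torusMeasure (Fin n)‖ ≤ ε := by
  have hmem : f ∈ closure (Submodule.span ℂ
      (Set.range (UnitAddTorus.mFourier (d := Fin n))) : Set C(UnitAddTorus (Fin n), ℂ)) := by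
    rw [← Submodule.topologicalClosure_coe, UnitAddTorus.span_mFourier_closure_eq_top]
    trivial
  obtain ⟨g, hg, hfg⟩ := Metric.mem_closure_iff.1 hmem (ε / 2) (half_pos hε)
  rw [dist_eq_norm] at hfg
  obtain ⟨M, hM⟩ := exists_integral_comp_phases_eq (d := d) hg
  refine ⟨M, fun v hv hl => ?_⟩
  have hpt : ∀ y, ‖f y - g y‖ ≤ ε / 2 := fun y => ((f - g).norm_coe_le_norm y).trans hfg.le
  have h1 : ‖∫ ξ in Set.Icc (0 : Fin d → ℝ) 1, (f (phases v ξ) - g (phases v ξ))‖ ≤ ε / 2 := by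
    simpa using norm_integral_le_of_norm_le_const
      (μ := volume.restrict (Set.Icc (0 : Fin d → ℝ) 1)) (.of_forall fun ξ => hpt (phases v ξ))
  have h2 : ‖∫ y, (f y - g y) ∂torusMeasure (Fin n)‖ ≤ ε / 2 := by
    simpa using norm_integral_le_of_norm_le_const (μ := torusMeasure (Fin n)) (.of_forall hpt)
  rw [integral_sub (integrableOn_comp_phases v f) (integrableOn_comp_phases v g)] at h1
  rw [integral_sub f.continuous.integrable_of_compactSpace
    g.continuous.integrable_of_compactSpace, ← hM v hv hl] at h2
  calc _ = ‖(_ - _) - (_ - _)‖ := by rw [sub_sub_sub_cancel_right]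
    _ ≤ ε / 2 + ε / 2 := (norm_sub_le _ _).trans (add_le_add h1 h2)
    _ = ε := add_halves ε

lemma rieszSum_phases {d n : ℕ} (v : Fin n → Fin d → ℤ) (ξ : Fin d → ℝ) :
    rieszSum n (phases v ξ) = ∑ j : Fin n,
      Complex.exp (2 * Real.pi * Complex.I * (∑ i, (v j i : ℝ) * ξ i)) *
        ∏ k ∈ Finset.Iio j,
          ((1 + Real.cos (2 * Real.pi * ∑ i, (v k i : ℝ) * ξ i) : ℝ) : ℂ) := by
  have h : ∀ t : ℝ, fourier 1 (t : UnitAddCircle) = Complex.exp (2 * Real.pi * Complex.I * t) := by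
    intro t
    rw [fourier_coe_apply]
    simp
  have h' : ∀ t : ℝ, (fourier 1 (t : UnitAddCircle)).re = Real.cos (2 * Real.pi * t) := by
    intro t
    rw [h, ← Complex.exp_ofReal_mul_I_re]
    congr 2
    push_cast
    ring
  simp only [rieszSum, phases, h']
  refine Finset.sum_congr rfl fun j _ => ?_
  rw [h]

/-- There is a constant `C > 0` such that for each `n` there is a lacunarity threshold `M(n)`
so that for every lacunary sequence `d^1,…,d^n` in `ℤ^d \ {0}` the exponential
Riesz-product sum has `L¹([0,1]^d)` norm at least `C·n`. -/
theorem riesz_product_lower_bound_exp (d : ℕ) :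
    ∃ C : ℝ, 0 < C ∧ ∀ n : ℕ, 0 < n →
      ∃ M : ℝ, 0 < M ∧
        ∀ v : Fin n → (Fin d → ℤ), (∀ k, v k ≠ 0) →
          (∀ k l : Fin n, (l : ℕ) = (k : ℕ) + 1 → M * intNorm (v k) < intNorm (v l)) →
          C * n ≤ ∫ ξ in Set.Icc (0 : Fin d → ℝ) 1,
            ‖∑ j : Fin n,
                Complex.exp (2 * Real.pi * Complex.I * (∑ i, (v j i : ℝ) * ξ i)) *
              ∏ k ∈ Finset.Iio j,
                ((1 + Real.cos (2 * Real.pi * ∑ i, (v k i : ℝ) * ξ i) : ℝ) : ℂ)‖ := by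
  refine ⟨1 / 131088, by norm_num, fun n hn => ?_⟩
  have hc := continuous_rieszSum n
  let f : C(UnitAddTorus (Fin n), ℂ) := ⟨fun y => (‖rieszSum n y‖ : ℂ), by fun_prop⟩
  obtain ⟨M, hM⟩ := exists_norm_integral_comp_phases_sub_le d f
    (ε := 1 / 131088) (by norm_num)
  refine ⟨max M 1, by positivity, fun v hv hl => ?_⟩
  have hclose := hM v hv (IsLacunary.mono (M := max M 1) hl (le_max_left _ _))
  simp only [f, ContinuousMap.coe_mk] at hclose
  rw [integral_complex_ofReal, integral_complex_ofReal, ← Complex.ofReal_sub, Complex.norm_real,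
    Real.norm_eq_abs, abs_le] at hclose
  simp only [← rieszSum_phases]
  have hn1 : (1 : ℝ) ≤ n := by exact_mod_cast hn
  linarith [hclose.1, integral_norm_rieszSum_ge n]
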